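/- arXiv:2108.03276 — 2 statements merged into one kernel-verified Lean document; each statement's English description precedes it below -/
import Mathlib

section
/- Let n ∈ ℕ₀, λ ∈ ℂ with λ+1 not a nonpositive integer, and x ∈ (−1,1) with x ≠ 0. Then the quadratic transformation P_n^{(λ,1/2)}(2x²−1) = (2^λ Γ(λ+n+1)/(n! x (1−x²)^{λ/2})) 𝖯_{2n+λ+1}^{−λ}(x) holds, relating the Jacobi polynomial of argument 2x²−1 to the Ferrers function of the first kind of odd degree shift. -/
/-- Pochhammer symbol `(a)_k = a (a+1) ⋯ (a+k-1)` for complex `a`. -/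
noncomputable def cpoch (a : ℂ) (k : ℕ) : ℂ := ∏ i ∈ Finset.range k, (a + i)

/-- Gauss hypergeometric series `₂F₁(a, b; c; z)`. -/
noncomputable def hyp2F1 (a b c z : ℂ) : ℂ :=
  ∑' k : ℕ, cpoch a k * cpoch b k / (cpoch c k * (Nat.factorial k : ℂ)) * z ^ k

/-- Ferrers function of the first kind `𝖯_ν^{−μ}(x)`. -/
noncomputable def ferrersP (ν μ : ℂ) (x : ℝ) : ℂ :=
  (1 / Complex.Gamma (μ + 1)) * (((1 - x) / (1 + x) : ℝ) : ℂ) ^ (μ / 2) *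
    hyp2F1 (-ν) (ν + 1) (μ + 1) (((1 - x) / 2 : ℝ) : ℂ)

/-- Jacobi polynomial `P_n^{(α,β)}(x)`. -/
noncomputable def jacobiP (n : ℕ) (α β : ℂ) (x : ℝ) : ℂ :=
  cpoch (α + 1) n / (Nat.factorial n : ℂ) *
    hyp2F1 (-(n : ℂ)) ((n : ℂ) + α + β + 1) (α + 1) (((1 - x) / 2 : ℝ) : ℂ)

theorem cpoch_succ (a : ℂ) (k : ℕ) : cpoch a (k + 1) = cpoch a k * (a + k) :=
  Finset.prod_range_succ _ _

theorem cpoch_ne_zero {c : ℂ} (hc : ∀ k : ℕ, c ≠ -(k : ℂ)) (k : ℕ) : cpoch c k ≠ 0 :=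
  Finset.prod_ne_zero_iff.2 fun i _ h => hc i (eq_neg_of_add_eq_zero_left h)

theorem cpoch_neg_natCast_eq_zero {n k : ℕ} (h : n < k) : cpoch (-(n : ℂ)) k = 0 :=
  Finset.prod_eq_zero (Finset.mem_range.2 h) (neg_add_cancel _)

theorem Gamma_add_natCast {c : ℂ} (hc : ∀ k : ℕ, c ≠ -(k : ℂ)) (n : ℕ) :
    Complex.Gamma (c + n) = cpoch c n * Complex.Gamma c := by
  induction n with
  | zero => simp [cpoch]
  | succ n ih =>
    have h : c + n ≠ 0 := fun h => hc n (eq_neg_of_add_eq_zero_left h)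
    rw [cpoch_succ, Nat.cast_succ, ← add_assoc, Complex.Gamma_add_one _ h, ih]
    ring

/-- The coefficients of the Gauss hypergeometric series. -/
noncomputable def hypCoeff (a b c : ℂ) (k : ℕ) : ℂ :=
  cpoch a k * cpoch b k / (cpoch c k * (Nat.factorial k : ℂ))

theorem hypCoeff_succ {a b c : ℂ} (hc : ∀ k : ℕ, c ≠ -(k : ℂ)) (k : ℕ) :
    (k + 1) * (c + k) * hypCoeff a b c (k + 1) = (a + k) * (b + k) * hypCoeff a b c k := by
  have h : c + k ≠ 0 := fun h => hc k (eq_neg_of_add_eq_zero_left h)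
  have h1 := cpoch_ne_zero hc k
  have h2 : (Nat.factorial k : ℂ) ≠ 0 := Nat.cast_ne_zero.2 (Nat.factorial_ne_zero k)
  have h3 : (k : ℂ) + 1 ≠ 0 := Nat.cast_add_one_ne_zero k
  simp only [hypCoeff, cpoch_succ, Nat.factorial_succ, Nat.cast_mul, Nat.cast_succ]
  field_simp

/-- The derivatives of a solution of the hypergeometric equation solve the equation with
shifted parameters. -/
theorem iteratedDeriv_hypergeometric_ode {a b c : ℂ} {f : ℂ → ℂ} {U : Set ℂ} (hU : IsOpen U)
    (hf : DifferentiableOn ℂ f U)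
    (hode : ∀ z ∈ U, z * (1 - z) * deriv (deriv f) z + (c - (a + b + 1) * z) * deriv f z
      - a * b * f z = 0) (k : ℕ) :
    ∀ z ∈ U, z * (1 - z) * iteratedDeriv (k + 2) f z
      + (c + k - (a + b + 1 + 2 * k) * z) * iteratedDeriv (k + 1) f z
      - (a + k) * (b + k) * iteratedDeriv k f z = 0 := by
  have hd : ∀ k : ℕ, DifferentiableOn ℂ (iteratedDeriv k f) U := by
    intro k
    induction k with
    | zero => simpa using hf
    | succ k ih => rw [iteratedDeriv_succ]; exact ih.deriv hU
  have hh : ∀ (k : ℕ), ∀ z ∈ U,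
      HasDerivAt (iteratedDeriv k f) (iteratedDeriv (k + 1) f z) z := by
    intro k z hz
    rw [iteratedDeriv_succ]
    exact ((hd k).differentiableAt (hU.mem_nhds hz)).hasDerivAt
  induction k with
  | zero => intro z hz; simpa [iteratedDeriv_succ] using hode z hz
  | succ k ih =>
    intro z hz
    have hid := hasDerivAt_id' z
    have h := (((hid.mul (hid.const_sub 1)).mul (hh (k + 2) z hz)).add
      (((hid.const_mul (a + b + 1 + 2 * (k : ℂ))).const_sub (c + k)).mul (hh (k + 1) z hz))).sub
      ((hh k z hz).const_mul ((a + k) * (b + k)))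
    have h0 := h.congr_of_eventuallyEq (f₁ := fun _ => (0 : ℂ)) (by
      filter_upwards [hU.mem_nhds hz] with w hw
      simpa using (ih w hw).symm)
    have h1 := h0.unique (hasDerivAt_const z (0 : ℂ))
    simp only [Pi.mul_apply] at h1
    push_cast
    linear_combination h1

/-- A solution of the hypergeometric equation holomorphic on the unit disc is given by the
hypergeometric series. -/
theorem eq_hyp2F1_of_ode {a b c : ℂ} (hc : ∀ k : ℕ, c ≠ -(k : ℂ)) {f : ℂ → ℂ}
    (hf : DifferentiableOn ℂ f (Metric.ball 0 1)) (hf0 : f 0 = 1)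
    (hode : ∀ z ∈ Metric.ball (0 : ℂ) 1, z * (1 - z) * deriv (deriv f) z
      + (c - (a + b + 1) * z) * deriv f z - a * b * f z = 0)
    {z : ℂ} (hz : z ∈ Metric.ball (0 : ℂ) 1) : f z = hyp2F1 a b c z := by
  have hcoef : ∀ k : ℕ, iteratedDeriv k f 0 = (Nat.factorial k : ℂ) * hypCoeff a b c k := by
    intro k
    induction k with
    | zero => simp [hypCoeff, cpoch, hf0]
    | succ k ih =>
      have h := iteratedDeriv_hypergeometric_ode Metric.isOpen_ball hf hode k 0 (by simp)
      have h1 : c + k ≠ 0 := fun h => hc k (eq_neg_of_add_eq_zero_left h)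
      apply mul_left_cancel₀ h1
      rw [Nat.factorial_succ]
      push_cast
      linear_combination h + (a + k) * (b + k) * ih
        - (Nat.factorial k : ℂ) * hypCoeff_succ (a := a) (b := b) hc k
  rw [← Complex.taylorSeries_eq_on_ball' hz hf]
  refine tsum_congr fun k => ?_
  have h2 : (Nat.factorial k : ℂ) ≠ 0 := Nat.cast_ne_zero.2 (Nat.factorial_ne_zero k)
  rw [hcoef, sub_zero, inv_mul_cancel_left₀ h2]
  rfl

/-- The terminating hypergeometric series `₂F₁(-n, b; c; X)`. -/
noncomputable def hypPoly (n : ℕ) (b c : ℂ) : Polynomial ℂ :=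
  ∑ k ∈ Finset.range (n + 1), Polynomial.monomial k (hypCoeff (-n) b c k)

theorem hypCoeff_neg_natCast_eq_zero {n k : ℕ} (h : n < k) (b c : ℂ) :
    hypCoeff (-n) b c k = 0 := by
  simp [hypCoeff, cpoch_neg_natCast_eq_zero h]

theorem coeff_hypPoly (n : ℕ) (b c : ℂ) (k : ℕ) :
    (hypPoly n b c).coeff k = hypCoeff (-n) b c k := by
  simp only [hypPoly, Polynomial.finsetSum_coeff, Polynomial.coeff_monomial,
    Finset.sum_ite_eq', Finset.mem_range]
  split_ifs with h
  · rfl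
  · exact (hypCoeff_neg_natCast_eq_zero (by omega) b c).symm

theorem hyp2F1_neg_natCast (n : ℕ) (b c z : ℂ) :
    hyp2F1 (-n) b c z = (hypPoly n b c).eval z := by
  simp only [hypPoly, Polynomial.eval_finsetSum, Polynomial.eval_monomial]
  refine tsum_eq_sum fun k hk => ?_
  rw [← hypCoeff, hypCoeff_neg_natCast_eq_zero (by simpa using hk), zero_mul]

open Polynomial in
theorem hypPoly_ode (n : ℕ) {b c : ℂ} (hc : ∀ k : ℕ, c ≠ -(k : ℂ)) (z : ℂ) :
    z * (1 - z) * (derivative (derivative (hypPoly n b c))).eval z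
      + (c - (-n + b + 1) * z) * (derivative (hypPoly n b c)).eval z
      + n * b * (hypPoly n b c).eval z = 0 := by
  set p := hypPoly n b c with hp
  have h : X * derivative (derivative p) - X * (X * derivative (derivative p))
      + C c * derivative p - C (-n + b + 1) * (X * derivative p) + C (n * b) * p = 0 := by
    ext k
    have hs := hypCoeff_succ (a := -n) (b := b) hc k
    rcases k with _ | _ | k <;>
      simp [-map_add, -map_mul, -map_neg, mul_coeff_zero, coeff_C_mul,
        coeff_X_mul, coeff_derivative, hp, coeff_hypPoly] at hs ⊢ <;>
      linear_combination hs
  have h' := congrArg (eval z) h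
  simp only [eval_add, eval_sub, eval_mul, eval_X, eval_C, eval_zero] at h'
  linear_combination h'

theorem one_sub_mem_slitPlane {z : ℂ} (hz : z ∈ Metric.ball (0 : ℂ) 1) :
    1 - z ∈ Complex.slitPlane := by
  rw [mem_ball_zero_iff] at hz
  left
  have := (Complex.abs_re_le_norm z).trans_lt hz
  simp only [Complex.sub_re, Complex.one_re]
  linarith [(abs_lt.1 this).2]

/-- Quadratic transformation of a terminating hypergeometric series. -/
theorem hyp2F1_quadratic_odd (n : ℕ) {lam : ℂ} (hlam : ∀ k : ℕ, lam + 1 ≠ -(k : ℂ)) {z : ℂ}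
    (hz : z ∈ Metric.ball (0 : ℂ) 1) :
    (1 - z) ^ lam * ((1 - 2 * z) * hyp2F1 (-n) (n + lam + 3 / 2) (lam + 1) (4 * z * (1 - z))) =
      hyp2F1 (-(2 * n + lam + 1)) (2 * n + lam + 2) (lam + 1) z := by
  rw [hyp2F1_neg_natCast]
  set p := hypPoly n (n + lam + 3 / 2) (lam + 1) with hp
  set p1 := Polynomial.derivative p with hp1
  set p2 := Polynomial.derivative p1 with hp2
  set s : ℂ → ℂ := fun t => 4 * t * (1 - t) with hs
  set w : ℂ → ℂ := fun t => (1 - t) ^ lam with hw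
  set f : ℂ → ℂ := fun t => w t * ((1 - 2 * t) * p.eval (s t)) with hf
  set g : ℂ → ℂ := fun t => w t * (-2 * p.eval (s t) + 4 * (1 - 2 * t) ^ 2 * p1.eval (s t)
    - lam * ((1 - 2 * t) * p.eval (s t)) / (1 - t)) with hg
  have hsd : ∀ t, HasDerivAt s (4 * (1 - 2 * t)) t := by
    intro t
    refine (((hasDerivAt_id' t).const_mul 4).mul ((hasDerivAt_id' t).const_sub 1)).congr_deriv ?_
    ring
  have hne : ∀ t ∈ Metric.ball (0 : ℂ) 1, 1 - t ≠ 0 := fun t ht =>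
    Complex.slitPlane_ne_zero (one_sub_mem_slitPlane ht)
  have hwd : ∀ t ∈ Metric.ball (0 : ℂ) 1, HasDerivAt w (-lam * w t / (1 - t)) t := by
    intro t ht
    refine (((hasDerivAt_id' t).const_sub 1).cpow_const (c := lam)
      (one_sub_mem_slitPlane ht)).congr_deriv ?_
    simp only [hw, Complex.cpow_sub _ _ (hne t ht), Complex.cpow_one]
    ring
  have hpd : ∀ (q : Polynomial ℂ) (t : ℂ), HasDerivAt (fun t => q.eval (s t))
      ((Polynomial.derivative q).eval (s t) * (4 * (1 - 2 * t))) t := fun q t =>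
    (q.hasDerivAt (s t)).comp t (hsd t)
  have hlin : ∀ t : ℂ, HasDerivAt (fun t : ℂ => 1 - 2 * t) (-2) t := by
    intro t
    simpa using ((hasDerivAt_id t).const_mul 2).const_sub 1
  have hfd : ∀ t ∈ Metric.ball (0 : ℂ) 1, HasDerivAt f (g t) t := by
    intro t ht
    refine ((hwd t ht).mul ((hlin t).mul (hpd p t))).congr_deriv ?_
    simp only [hg, ← hp1, Pi.mul_apply]
    ring
  have hgd : ∀ t ∈ Metric.ball (0 : ℂ) 1, HasDerivAt g
      (w t * (-24 * (1 - 2 * t) * p1.eval (s t) + 16 * (1 - 2 * t) ^ 3 * p2.eval (s t)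
        - 2 * lam / (1 - t) * (-2 * p.eval (s t) + 4 * (1 - 2 * t) ^ 2 * p1.eval (s t))
        + lam * (lam - 1) / (1 - t) ^ 2 * ((1 - 2 * t) * p.eval (s t)))) t := by
    intro t ht
    have h1 := hne t ht
    refine ((hwd t ht).mul ((((hpd p t).const_mul (-2)).add ((((hlin t).pow 2).const_mul 4).mul
      (hpd p1 t))).sub ((((hlin t).mul (hpd p t)).const_mul lam).div
      ((hasDerivAt_id' t).const_sub 1) h1))).congr_deriv ?_
    simp only [← hp1, ← hp2, Pi.mul_apply, Pi.pow_apply, Pi.add_apply, Pi.sub_apply, Pi.div_apply]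
    field_simp
    ring
  refine eq_hyp2F1_of_ode hlam (f := f) (fun t ht =>
    (hfd t ht).differentiableAt.differentiableWithinAt) ?_ ?_ hz
  · simp only [hf, hw, hs, mul_zero, zero_mul, sub_zero, Complex.one_cpow, one_mul]
    rw [← Polynomial.coeff_zero_eq_eval_zero, coeff_hypPoly]
    simp [hypCoeff, cpoch]
  · intro t ht
    have hdd : deriv (deriv f) t = deriv g t := Filter.EventuallyEq.deriv_eq <| by
      filter_upwards [Metric.isOpen_ball.mem_nhds ht] with u hu using (hfd u hu).deriv
    have h1 := hne t ht
    have hode := hypPoly_ode n (b := n + lam + 3 / 2) hlam (s t)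
    rw [← hp, ← hp1, ← hp2] at hode
    rw [hdd, (hfd t ht).deriv, (hgd t ht).deriv]
    simp only [hf, hg]
    generalize w t = W at *
    have hst : s t = 4 * t * (1 - t) := rfl
    generalize p.eval (s t) = P at *
    generalize p1.eval (s t) = P1 at *
    generalize p2.eval (s t) = P2 at *
    rw [hst] at hode
    field_simp
    field_simp at hode
    linear_combination 2 * W * (1 - 2 * t) * (1 - t) * hode

theorem jacobiP_eq_ferrersP_odd (n : ℕ) (lam : ℂ) (hlam : ∀ k : ℕ, lam + 1 ≠ -(k : ℂ))
    (x : ℝ) (hx : x ∈ Set.Ioo (-1 : ℝ) 1) (hx0 : x ≠ 0) :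
    jacobiP n lam (1 / 2) (2 * x ^ 2 - 1) =
      (2 : ℂ) ^ lam * Complex.Gamma (lam + n + 1) /
          ((Nat.factorial n : ℂ) * (x : ℂ) * ((1 - x ^ 2 : ℝ) : ℂ) ^ (lam / 2)) *
        ferrersP (2 * (n : ℂ) + lam + 1) lam x := by
  obtain ⟨hx1, hx2⟩ := hx
  have hA : 0 < 1 - x := by linarith
  have hB : 0 < 1 + x := by linarith
  have hxc : (x : ℂ) ≠ 0 := Complex.ofReal_ne_zero.2 hx0
  have hz : (((1 - x) / 2 : ℝ) : ℂ) ∈ Metric.ball (0 : ℂ) 1 := by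
    rw [mem_ball_zero_iff, Complex.norm_real, Real.norm_eq_abs, abs_lt]
    constructor <;> linarith
  have hq := hyp2F1_quadratic_odd n hlam hz
  have hpow : (((1 - x) / (1 + x) : ℝ) : ℂ) ^ (lam / 2) * (2 : ℂ) ^ lam
      * (1 - (((1 - x) / 2 : ℝ) : ℂ)) ^ lam = ((1 - x ^ 2 : ℝ) : ℂ) ^ (lam / 2) := by
    have e1 : 1 - (((1 - x) / 2 : ℝ) : ℂ) = (((1 + x) / 2 : ℝ) : ℂ) := by push_cast; ring
    have e3 : 1 - x ^ 2 = (1 - x) * (1 + x) := by ring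
    have hexp : ∀ {r : ℝ}, 0 < r → ∀ c : ℂ, (r : ℂ) ^ c = Complex.exp (Real.log r * c) := by
      intro r hr c
      rw [Complex.cpow_def_of_ne_zero (Complex.ofReal_ne_zero.2 hr.ne'), Complex.ofReal_log hr.le]
    rw [e1, e3, show (2 : ℂ) ^ lam = ((2 : ℝ) : ℂ) ^ lam by norm_num, hexp (by positivity),
      hexp (by positivity), hexp (by positivity), hexp (by positivity), ← Complex.exp_add,
      ← Complex.exp_add, Real.log_div hA.ne' hB.ne', Real.log_div hB.ne' two_ne_zero,
      Real.log_mul hA.ne' hB.ne']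
    congr 1
    push_cast
    ring
  have hpow0 : ((1 - x ^ 2 : ℝ) : ℂ) ^ (lam / 2) ≠ 0 := by
    have : (0 : ℝ) < 1 - x ^ 2 := by nlinarith
    rw [Complex.cpow_ne_zero_iff]
    exact Or.inl (Complex.ofReal_ne_zero.2 this.ne')
  have hG : Complex.Gamma (lam + 1) ≠ 0 := Complex.Gamma_ne_zero hlam
  have hfac : (Nat.factorial n : ℂ) ≠ 0 := Nat.cast_ne_zero.2 (Nat.factorial_ne_zero n)
  rw [jacobiP, ferrersP, show lam + n + 1 = lam + 1 + n by ring, Gamma_add_natCast hlam,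
    show 2 * (n : ℂ) + lam + 1 + 1 = 2 * n + lam + 2 by ring, ← hq,
    show (n : ℂ) + lam + 1 / 2 + 1 = n + lam + 3 / 2 by ring,
    show (((1 - (2 * x ^ 2 - 1)) / 2 : ℝ) : ℂ) =
      4 * (((1 - x) / 2 : ℝ) : ℂ) * (1 - (((1 - x) / 2 : ℝ) : ℂ)) by push_cast; ring,
    show 1 - 2 * (((1 - x) / 2 : ℝ) : ℂ) = x by push_cast; ring]
  generalize hyp2F1 _ _ _ _ = H
  rw [← hpow] at hpow0 ⊢
  generalize (2 : ℂ) ^ lam = T at *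
  generalize (((1 - x) / (1 + x) : ℝ) : ℂ) ^ (lam / 2) = Y at *
  generalize (1 - (((1 - x) / 2 : ℝ) : ℂ)) ^ lam = V at *
  obtain ⟨⟨hY, hT⟩, hV⟩ : (Y ≠ 0 ∧ T ≠ 0) ∧ V ≠ 0 := by simpa using hpow0
  field_simp
end

section
/- Let x ∈ (−1,1), n ∈ ℕ₀, and μ ∈ ℂ with μ+1 not a nonpositive integer. Then the Rodrigues-type formula 𝖯_{n+μ}^{−μ}(x) = ((−1)^n / (2^{μ+n} Γ(μ+n+1) (1−x²)^{μ/2})) · (d/dx)^n [ (1−x²)^{μ+n} ] holds, where (d/dx)^n denotes the n-th derivative with respect to x. -/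
open Complex Filter Topology

lemma cpoch_eq_ascPochhammer_eval (a : ℂ) (k : ℕ) : cpoch a k = (ascPochhammer ℂ k).eval a := by
  induction k with
  | zero => simp [cpoch]
  | succ k ih => rw [ascPochhammer_succ_eval, ← ih, cpoch, cpoch, Finset.prod_range_succ]

lemma cpoch_succ_left (a : ℂ) (k : ℕ) : cpoch a (k + 1) = a * cpoch (a + 1) k := by
  simp only [cpoch, Finset.prod_range_succ']
  push_cast
  rw [mul_comm, add_zero]
  congr 1
  exact Finset.prod_congr rfl fun i _ => by ring

lemma cpoch_add (a : ℂ) (m k : ℕ) : cpoch a (m + k) = cpoch a m * cpoch (a + m) k := by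
  simp only [cpoch, Finset.prod_range_add, Nat.cast_add, add_assoc]

lemma cpoch_ne_zero_s7 {a : ℂ} (ha : ∀ k : ℕ, a ≠ -(k : ℂ)) (k : ℕ) : cpoch a k ≠ 0 :=
  Finset.prod_ne_zero_iff.2 fun i _ h => ha i (eq_neg_of_add_eq_zero_left h)

lemma Gamma_add_natCast_eq_cpoch_mul {a : ℂ} (ha : ∀ k : ℕ, a ≠ -(k : ℂ)) (n : ℕ) :
    Gamma (a + n) = cpoch a n * Gamma a := by
  rw [cpoch_eq_ascPochhammer_eval, ← Gamma_add_nat_div_Gamma_eq a ha,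
    div_mul_cancel₀ _ (Gamma_ne_zero ha)]

lemma ringChoose_eq_cpoch_div_factorial (a : ℂ) (k : ℕ) :
    Ring.choose (a + k - 1) k = cpoch a k / (k.factorial : ℂ) := by
  rw [← Ring.multichoose_eq, eq_div_iff (Nat.cast_ne_zero.2 k.factorial_ne_zero), mul_comm,
    ← nsmul_eq_mul, Ring.factorial_nsmul_multichoose_eq_ascPochhammer,
    Polynomial.ascPochhammer_smeval_eq_eval, cpoch_eq_ascPochhammer_eval]

lemma one_sub_cpow_hasFPowerSeriesOnBall (ν : ℂ) :
    HasFPowerSeriesOnBall (fun z : ℂ => (1 - z) ^ ν)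
      (.ofScalars ℂ fun k => cpoch (-ν) k / (k.factorial : ℂ)) 0 1 := by
  have h := one_div_one_sub_cpow_hasFPowerSeriesOnBall_zero (-ν)
  simpa only [ringChoose_eq_cpoch_div_factorial, cpow_neg, one_div, inv_inv] using h

lemma hasSum_one_sub_cpow (ν : ℂ) {z : ℂ} (hz : ‖z‖ < 1) :
    HasSum (fun k => cpoch (-ν) k / (k.factorial : ℂ) * z ^ k) ((1 - z) ^ ν) := by
  have h := (one_sub_cpow_hasFPowerSeriesOnBall ν).hasSum (y := z)
    (by simpa [mem_eball_zero_iff, enorm_eq_nnnorm, ← NNReal.coe_lt_coe] using hz)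
  simpa [FormalMultilinearSeries.ofScalars_apply_eq, smul_eq_mul, mul_comm] using h

lemma summable_norm_cpoch_div_factorial (ν : ℂ) {r : ℝ} (hr0 : 0 ≤ r) (hr1 : r < 1) :
    Summable fun k : ℕ => ‖cpoch (-ν) k / (k.factorial : ℂ)‖ * r ^ k := by
  have h := FormalMultilinearSeries.summable_norm_mul_pow _ (r := ⟨r, hr0⟩)
    (lt_of_lt_of_le (ENNReal.coe_lt_one_iff.2 hr1) (one_sub_cpow_hasFPowerSeriesOnBall ν).r_le)
  simp only [FormalMultilinearSeries.ofScalars_norm] at h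
  exact h

/-- Multiplying the coefficients of a power series by an affine function of the index
preserves absolute convergence on the open unit disc. -/
lemma summable_norm_add_natCast_mul {a : ℕ → ℂ}
    (ha : ∀ r : ℝ, 0 ≤ r → r < 1 → Summable fun k => ‖a k‖ * r ^ k) (s : ℂ)
    {r : ℝ} (hr0 : 0 ≤ r) (hr1 : r < 1) :
    Summable fun k : ℕ => ‖(s + k) * a k‖ * r ^ k := by
  obtain ⟨ρ, hrρ, hρ1⟩ := exists_between hr1
  have hρ0 : 0 < ρ := hr0.trans_lt hrρ
  have hq : ‖r / ρ‖ < 1 := by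
    rw [Real.norm_of_nonneg (by positivity)]
    exact (div_lt_one hρ0).2 hrρ
  have hs := ((summable_pow_mul_geometric_of_norm_lt_one 0 hq).mul_left ‖s‖).add
    (summable_pow_mul_geometric_of_norm_lt_one 1 hq)
  refine .of_nonneg_of_le (fun k => by positivity) (fun k => ?_)
    (hs.mul_left (∑' k, ‖a k‖ * ρ ^ k))
  have hk : ‖a k‖ * ρ ^ k ≤ ∑' k, ‖a k‖ * ρ ^ k :=
    (ha ρ hρ0.le hρ1).le_tsum k fun j _ => by positivity
  have hsk : ‖s + k‖ ≤ ‖s‖ + k := (norm_add_le _ _).trans (by simp)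
  calc ‖(s + k) * a k‖ * r ^ k = (‖a k‖ * ρ ^ k) * (‖s + k‖ * (r / ρ) ^ k) := by
        rw [norm_mul, div_pow]; field_simp
    _ ≤ (∑' k, ‖a k‖ * ρ ^ k) * ((‖s‖ + k) * (r / ρ) ^ k) := by gcongr
    _ = _ := by ring

lemma hasDerivAt_tsum_mul_pow {a : ℕ → ℂ}
    (ha : ∀ r : ℝ, 0 ≤ r → r < 1 → Summable fun k => ‖a k‖ * r ^ k) {z : ℂ} (hz : ‖z‖ < 1) :
    HasDerivAt (fun w => ∑' k, a k * w ^ k) (∑' k : ℕ, a k * (k * z ^ (k - 1))) z := by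
  obtain ⟨ρ, hzρ, hρ1⟩ := exists_between hz
  have hρ0 : 0 < ρ := (norm_nonneg z).trans_lt hzρ
  have hu := (summable_norm_add_natCast_mul ha 0 hρ0.le hρ1).mul_left ρ⁻¹
  refine hasDerivAt_tsum_of_isPreconnected hu Metric.isOpen_ball
    (convex_ball (0 : ℂ) ρ).isPreconnected
    (fun k y _ => (hasDerivAt_pow k y).const_mul (a k)) (fun k y hy => ?_)
    (by simpa using hzρ : z ∈ Metric.ball (0 : ℂ) ρ) ?_ (by simpa using hzρ)
  · have hy' : ‖y‖ ≤ ρ := by simpa using (mem_ball_zero_iff.1 hy).le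
    rcases k with _ | k
    · simp
    · simp only [zero_add, norm_mul, norm_pow, add_tsub_cancel_right]
      calc _ ≤ ‖a (k + 1)‖ * (‖((k + 1 : ℕ) : ℂ)‖ * ρ ^ k) := by gcongr
        _ = _ := by rw [pow_succ]; field_simp
  · exact .of_norm (by simpa using ha _ (norm_nonneg z) hz)

lemma hasDerivAt_cpow_mul_tsum {a : ℕ → ℂ}
    (ha : ∀ r : ℝ, 0 ≤ r → r < 1 → Summable fun k => ‖a k‖ * r ^ k) (s : ℂ) {z : ℂ}
    (hz : ‖z‖ < 1) (hz' : z ∈ slitPlane) :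
    HasDerivAt (fun w => w ^ s * ∑' k, a k * w ^ k)
      (z ^ (s - 1) * ∑' k : ℕ, (s + k) * a k * z ^ k) z := by
  have hz0 : z ≠ 0 := slitPlane_ne_zero hz'
  have h := ((hasDerivAt_id z).cpow_const (c := s) hz').mul (hasDerivAt_tsum_mul_pow ha hz)
  refine h.congr_deriv ?_
  have h1 : Summable fun k => a k * z ^ k := .of_norm (by simpa using ha _ (norm_nonneg z) hz)
  have h2 : Summable fun k : ℕ => (k : ℂ) * a k * z ^ k := .of_norm (by
    simpa using summable_norm_add_natCast_mul ha 0 (norm_nonneg z) hz)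
  have h3 : z * ∑' k : ℕ, a k * (k * z ^ (k - 1)) = ∑' k : ℕ, (k : ℂ) * a k * z ^ k := by
    rw [← tsum_mul_left]
    refine tsum_congr fun k => ?_
    rcases k with _ | k
    · simp
    · rw [add_tsub_cancel_right, pow_succ]; ring
  have h4 : ∑' k : ℕ, (s + k) * a k * z ^ k
      = s * ∑' k, a k * z ^ k + ∑' k : ℕ, (k : ℂ) * a k * z ^ k := by
    rw [← tsum_mul_left, ← (h1.mul_left s).tsum_add h2]
    exact tsum_congr fun k => by ring
  have h5 : z ^ s = z ^ (s - 1) * z := by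
    rw [cpow_sub _ _ hz0, cpow_one, div_mul_cancel₀ _ hz0]
  rw [h4, ← h3, id, h5]
  ring

/-- Iterated derivatives of a generalized power series in the variable `(1 - y) / 2`. -/
lemma iteratedDeriv_cpow_mul_tsum {f : ℝ → ℂ} {a : ℕ → ℂ} {s : ℂ}
    (ha : ∀ r : ℝ, 0 ≤ r → r < 1 → Summable fun k => ‖a k‖ * r ^ k)
    (hf : ∀ y ∈ Set.Ioo (-1 : ℝ) 1, f y =
      (((1 - y) / 2 : ℝ) : ℂ) ^ s * ∑' k, a k * (((1 - y) / 2 : ℝ) : ℂ) ^ k) (m : ℕ) :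
    (∀ r : ℝ, 0 ≤ r → r < 1 → Summable fun k : ℕ => ‖cpoch (s - m + k + 1) m * a k‖ * r ^ k) ∧
    ∀ y ∈ Set.Ioo (-1 : ℝ) 1, iteratedDeriv m f y =
      (-1 / 2) ^ m * ((((1 - y) / 2 : ℝ) : ℂ) ^ (s - m) *
        ∑' k : ℕ, cpoch (s - m + k + 1) m * a k * (((1 - y) / 2 : ℝ) : ℂ) ^ k) := by
  induction m with
  | zero =>
    simp only [cpoch, Finset.range_zero, Finset.prod_empty, one_mul, Nat.cast_zero, sub_zero,
      pow_zero, iteratedDeriv_zero]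
    exact ⟨ha, hf⟩
  | succ m ih =>
    obtain ⟨hs, hd⟩ := ih
    have hcoef (k : ℕ) : cpoch (s - (m + 1 : ℕ) + k + 1) (m + 1) * a k
        = (s - m + k) * (cpoch (s - m + k + 1) m * a k) := by
      rw [cpoch_succ_left, show s - (m + 1 : ℕ) + k + 1 = s - m + k by push_cast; ring, mul_assoc]
    simp only [hcoef]
    refine ⟨fun r h0 h1 => summable_norm_add_natCast_mul hs _ h0 h1, fun y hy => ?_⟩
    have hpos : 0 < (1 - y) / 2 := by linarith [hy.2]
    have hlt : ‖(((1 - y) / 2 : ℝ) : ℂ)‖ < 1 := by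
      rw [norm_real, Real.norm_of_nonneg hpos.le]
      linarith [hy.1]
    have hin : HasDerivAt (fun y : ℝ => (((1 - y) / 2 : ℝ) : ℂ)) (-1 / 2) y := by
      have := (((hasDerivAt_id y).const_sub 1).div_const 2).ofReal_comp
      simpa using this
    have hev : iteratedDeriv m f =ᶠ[𝓝 y] _ :=
      eventually_of_mem (Ioo_mem_nhds hy.1 hy.2) hd
    rw [iteratedDeriv_succ, hev.deriv_eq]
    have h := (((hasDerivAt_cpow_mul_tsum hs (s - m) hlt
      (ofReal_mem_slitPlane.2 hpos)).comp y hin).const_mul ((-1 / 2 : ℂ) ^ m)).deriv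
    refine h.trans ?_
    rw [show s - (m + 1 : ℕ) = s - m - 1 by push_cast; ring]
    ring

lemma one_sub_sq_cpow_eq {y : ℝ} (hy : y ∈ Set.Ioo (-1 : ℝ) 1) (ν : ℂ) :
    (1 - (y : ℂ) ^ 2) ^ ν = (((1 - y) / 2 : ℝ) : ℂ) ^ ν *
      ∑' k : ℕ, (2 : ℂ) ^ ν * (2 : ℂ) ^ ν * (cpoch (-ν) k / (k.factorial : ℂ)) *
        (((1 - y) / 2 : ℝ) : ℂ) ^ k := by
  have hpos : 0 < (1 - y) / 2 := by linarith [hy.2]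
  have hpos' : 0 < (1 + y) / 2 := by linarith [hy.1]
  have hlt : ‖(((1 - y) / 2 : ℝ) : ℂ)‖ < 1 := by
    rw [norm_real, Real.norm_of_nonneg hpos.le]
    linarith [hy.1]
  have hsum := (hasSum_one_sub_cpow ν hlt).tsum_eq
  simp only [mul_assoc, tsum_mul_left] at hsum ⊢
  rw [hsum]
  have e1 : 1 - (y : ℂ) ^ 2 =
      (((1 - y) / 2 : ℝ) : ℂ) * ((2 : ℝ) * ((2 : ℝ) * (((1 + y) / 2 : ℝ) : ℂ))) := by
    push_cast; ring
  have e2 : 1 - (((1 - y) / 2 : ℝ) : ℂ) = (((1 + y) / 2 : ℝ) : ℂ) := by push_cast; ring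
  rw [e1, e2, ← ofReal_mul, ← ofReal_mul, mul_cpow_ofReal_nonneg hpos.le (by positivity), ofReal_mul,
    mul_cpow_ofReal_nonneg two_pos.le (by positivity), ofReal_mul,
    mul_cpow_ofReal_nonneg two_pos.le hpos'.le, ofReal_ofNat]

theorem ferrersP_rodrigues (x : ℝ) (hx : x ∈ Set.Ioo (-1 : ℝ) 1) (n : ℕ) (μ : ℂ)
    (hμ : ∀ k : ℕ, μ + 1 ≠ -(k : ℂ)) :
    ferrersP ((n : ℂ) + μ) μ x =
      (-1) ^ n /
          ((2 : ℂ) ^ (μ + n) * Complex.Gamma (μ + n + 1) * ((1 - x ^ 2 : ℝ) : ℂ) ^ (μ / 2)) *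
        iteratedDeriv n (fun y : ℝ => (1 - (y : ℂ) ^ 2) ^ (μ + (n : ℂ))) x := by
  have hA : 0 < 1 - x := by linarith [hx.2]
  have hB : 0 < 1 + x := by linarith [hx.1]
  have ha : ∀ r : ℝ, 0 ≤ r → r < 1 → Summable fun k : ℕ =>
      ‖(2 : ℂ) ^ (μ + n) * (2 : ℂ) ^ (μ + n) *
        (cpoch (-(μ + n)) k / (k.factorial : ℂ))‖ * r ^ k := fun r h0 h1 => by
    simpa only [norm_mul, mul_assoc] using
      (summable_norm_cpoch_div_factorial (μ + n) h0 h1).mul_left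
        ‖(2 : ℂ) ^ (μ + n) * (2 : ℂ) ^ (μ + n)‖
  rw [(iteratedDeriv_cpow_mul_tsum ha (fun y hy => one_sub_sq_cpow_eq hy (μ + n)) n).2 x hx]
  have hsum : ∑' k : ℕ, cpoch (μ + n - n + k + 1) n * ((2 : ℂ) ^ (μ + n) * (2 : ℂ) ^ (μ + n) *
        (cpoch (-(μ + n)) k / (k.factorial : ℂ))) * (((1 - x) / 2 : ℝ) : ℂ) ^ k
      = (2 : ℂ) ^ (μ + n) * (2 : ℂ) ^ (μ + n) * cpoch (μ + 1) n *
        hyp2F1 (-((n : ℂ) + μ)) ((n : ℂ) + μ + 1) (μ + 1) (((1 - x) / 2 : ℝ) : ℂ) := by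
    rw [hyp2F1, ← tsum_mul_left]
    refine tsum_congr fun k => ?_
    have hk := cpoch_ne_zero_s7 hμ k
    have hc : cpoch (μ + n - n + k + 1) n =
        cpoch (μ + 1) n * cpoch ((n : ℂ) + μ + 1) k / cpoch (μ + 1) k := by
      rw [eq_div_iff hk, add_sub_cancel_right, mul_comm, show μ + k + 1 = μ + 1 + k by ring,
        ← cpoch_add, add_comm k n, cpoch_add, show μ + 1 + n = n + μ + 1 by ring]
    rw [hc, add_comm (n : ℂ) μ]
    field_simp
  have hG : Gamma (μ + n + 1) = cpoch (μ + 1) n * Gamma (μ + 1) := by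
    rw [← Gamma_add_natCast_eq_cpoch_mul hμ, add_right_comm]
  have hsq : ((1 - x ^ 2 : ℝ) : ℂ) ^ (μ / 2)
      = ((1 - x : ℝ) : ℂ) ^ (μ / 2) * ((1 + x : ℝ) : ℂ) ^ (μ / 2) := by
    rw [← mul_cpow_ofReal_nonneg hA.le hB.le, ← ofReal_mul]
    congr 2; ring
  have hdiv : (((1 - x) / (1 + x) : ℝ) : ℂ) ^ (μ / 2)
      = ((1 - x : ℝ) : ℂ) ^ (μ / 2) / ((1 + x : ℝ) : ℂ) ^ (μ / 2) := by
    rw [ofReal_div, div_cpow_ofReal_nonneg hA.le hB.le]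
  have hA0 : ((1 - x : ℝ) : ℂ) ≠ 0 := ofReal_ne_zero.2 hA.ne'
  have hB0 : ((1 + x : ℝ) : ℂ) ≠ 0 := ofReal_ne_zero.2 hB.ne'
  have hhalf : (((1 - x) / 2 : ℝ) : ℂ) ^ (μ + n - n)
      = ((1 - x : ℝ) : ℂ) ^ (μ / 2) * ((1 - x : ℝ) : ℂ) ^ (μ / 2) / (2 : ℂ) ^ μ := by
    rw [add_sub_cancel_right, ofReal_div, div_cpow_ofReal_nonneg hA.le two_pos.le,
      ← cpow_add _ _ hA0, add_halves, ofReal_ofNat]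
  have h2 : (2 : ℂ) ^ (μ + n) = 2 ^ μ * 2 ^ n := by
    rw [cpow_add _ _ two_ne_zero, cpow_natCast]
  have h2μ : (2 : ℂ) ^ μ ≠ 0 := by simp [cpow_eq_zero_iff]
  have hAμ : ((1 - x : ℝ) : ℂ) ^ (μ / 2) ≠ 0 := by rw [Ne, cpow_eq_zero_iff]; tauto
  have hBμ : ((1 + x : ℝ) : ℂ) ^ (μ / 2) ≠ 0 := by rw [Ne, cpow_eq_zero_iff]; tauto
  have hP := cpoch_ne_zero_s7 hμ n
  have hG0 := Gamma_ne_zero hμ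
  have hsign : (-1 : ℂ) ^ n * (-1) ^ n = 1 := by rw [← mul_pow]; simp
  rw [hsum, ferrersP, hG, hsq, hdiv, hhalf, h2, div_pow]
  generalize ((1 - x : ℝ) : ℂ) ^ (μ / 2) = A at *
  generalize ((1 + x : ℝ) : ℂ) ^ (μ / 2) = B at *
  field_simp
  linear_combination (-hyp2F1 (-((n : ℂ) + μ)) (n + μ + 1) (μ + 1) (((1 - x) / 2 : ℝ) : ℂ)) * hsign
end
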